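/- arXiv:1507.01259 — 5 statements merged into one kernel-verified Lean document; each statement's English description precedes it below -/
import Mathlib

section
/- Let Γ be a group, (G,ψ) a Γ-labeled graph with finite edge set E, k a positive integer, and α: 2^Γ → {0,1,…,k} a polymatroidal function. Define f_α(F) = k|V(F)| − k + α̃(F) for F ∈ C(G). Then the family I_α(G) = { I ⊆ E : |F| ≤ f_α(F) for all F ∈ C(G) with F ⊆ I } is the family of independent sets of a matroid on E. -/
/- Formalization of count matroids of group-labeled graphs. -/

namespace CountMatroidPaper

attribute [local instance] Classical.propDecidable

/-- A `Γ`-labeled graph: a directed multigraph with edge set `E`, vertex set `V`,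
and a gain (group label) on each edge. -/
structure GainGraph (V E Γ : Type*) where
  tail : E → V
  head : E → V
  gain : E → Γ

variable {V E Γ : Type*}

namespace GainGraph

variable [Group Γ]

/-- `V(F)`: the set of vertices incident to the edge set `F`. -/
def verts [DecidableEq V] (G : GainGraph V E Γ) (F : Finset E) : Finset V :=
  F.image G.tail ∪ F.image G.head

/-- `G.GainWalk F u w g` : there is a walk from `u` to `w` using edges of `F` whose gain is `g`. -/
inductive GainWalk (G : GainGraph V E Γ) (F : Set E) (u : V) : V → Γ → Prop
  | nil : GainWalk G F u u 1
  | fwd {w : V} {g : Γ} {e : E} : GainWalk G F u w g → e ∈ F → G.tail e = w →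
      GainWalk G F u (G.head e) (g * G.gain e)
  | bwd {w : V} {g : Γ} {e : E} : GainWalk G F u w g → e ∈ F → G.head e = w →
      GainWalk G F u (G.tail e) (g * (G.gain e)⁻¹)

/-- An edge set is balanced if every closed walk in it has identity gain. -/
def Balanced (G : GainGraph V E Γ) (F : Set E) : Prop :=
  ∀ (v : V) (g : Γ), G.GainWalk F v v g → g = 1

/-- Membership in `C(G)` : a nonempty edge set `F` such that `(V(F), F)` is connected. -/
def Connected [DecidableEq V] (G : GainGraph V E Γ) (F : Finset E) : Prop :=
  F.Nonempty ∧ ∀ u ∈ G.verts F, ∀ w ∈ G.verts F, ∃ g : Γ, G.GainWalk (↑F) u w g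

/-- The set of gains of closed walks based at `v` using edges of `F`. -/
def gains (G : GainGraph V E Γ) (F : Set E) (v : V) : Set Γ :=
  {g | G.GainWalk F v v g}

/-- `α̃(F)`: the value of `α` on (a generating set of) the subgroup `⟨F⟩_{v,ψ}` for a
vertex `v ∈ V(F)`.  For a polymatroidal `α` (invariant under conjugation and under taking
generated subgroups) this is independent of the choice of `v`. -/
noncomputable def alphaTilde (α : Set Γ → ℤ) (G : GainGraph V E Γ) (F : Finset E) : ℤ :=
  if h : F.Nonempty then α (G.gains (↑F) (G.tail h.choose)) else 0

/-- Loops at `v`. -/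
def loopsAt (G : GainGraph V E Γ) (v : V) : Set E :=
  {e | G.tail e = v ∧ G.head e = v}

/-- Unbalanced (non-identity labeled) loops at `v`, i.e. `L_v \ L_v°`. -/
def unbalancedLoopsAt (G : GainGraph V E Γ) (v : V) : Set E :=
  {e | G.tail e = v ∧ G.head e = v ∧ G.gain e ≠ 1}

/-- `E_v`: edges incident to `v`. -/
def incidentAt (G : GainGraph V E Γ) (v : V) : Set E :=
  {e | G.tail e = v ∨ G.head e = v}

/-- Non-loop edges incident to `v`. -/
def nonloopAt (G : GainGraph V E Γ) (v : V) : Set E :=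
  {e | (G.tail e = v ∨ G.head e = v) ∧ G.tail e ≠ G.head e}

/-- The split of `(G,ψ)` at `v` with respect to the bipartition `{E₁, E₂}` of the non-loop
edges incident to `v`, where `B = E₂`: the vertex `v` is split into `v₁ = Sum.inl v` and
`v₂ = Sum.inr ()`; edges in `B` become incident to `v₂`, the remaining non-loop edges at `v`
to `v₁`; balanced loops at `v` stay loops at `v₁`, and unbalanced loops at `v` become arcs
from `v₁` to `v₂`, keeping the labeling. -/
noncomputable def split (G : GainGraph V E Γ) (v : V) (B : Set E) :
    GainGraph (V ⊕ Unit) E Γ where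
  tail e :=
    if G.tail e = v ∧ G.head e = v then Sum.inl v
    else if G.tail e = v ∧ e ∈ B then Sum.inr ()
    else Sum.inl (G.tail e)
  head e :=
    if G.tail e = v ∧ G.head e = v then
      (if G.gain e = 1 then Sum.inl v else Sum.inr ())
    else if G.head e = v ∧ e ∈ B then Sum.inr ()
    else Sum.inl (G.head e)
  gain := G.gain

/-- `v` is a base for the near-balancedness of `F`, witnessed by the part `B` of the
bipartition of the non-loop edges at `v`: the corresponding split makes `F` balanced. -/
def IsSplitBase (G : GainGraph V E Γ) (F : Finset E) (v : V) (B : Set E) : Prop :=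
  B ⊆ G.nonloopAt v ∧ Balanced (G.split v B) (↑F)

/-- A connected edge set is near-balanced if it is unbalanced and some split of `(G,ψ)`
makes it balanced. -/
def NearBalanced (G : GainGraph V E Γ) (F : Finset E) : Prop :=
  ¬ G.Balanced (↑F) ∧ ∃ (v : V) (B : Set E), G.IsSplitBase F v B

/-- `K` is an extra edge set for the near-balancedness of `F` with base `v`:
`K = E₂ ∪ (L_v \ L_v°)` (or `E₁ ∪ (L_v \ L_v°)`) for a balanced split at `v` with
bipartition `{E₁, E₂}`. -/
def ExtraEdgeSet (G : GainGraph V E Γ) (F : Finset E) (v : V) (K : Set E) : Prop :=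
  ∃ B : Set E, G.IsSplitBase F v B ∧
    (K = B ∪ G.unbalancedLoopsAt v ∨
     K = (G.nonloopAt v \ B) ∪ G.unbalancedLoopsAt v)

/-- `β(F)`. -/
noncomputable def beta (α : Set Γ → ℤ) (k : ℤ) [DecidableEq V]
    (G : GainGraph V E Γ) (F : Finset E) : ℤ :=
  if G.NearBalanced F then min (alphaTilde α G F) k else alphaTilde α G F

/-- `f_α(F) = k|V(F)| - ℓ + β(F)`. -/
noncomputable def fAlpha (α : Set Γ → ℤ) (k ℓ : ℤ) [DecidableEq V]
    (G : GainGraph V E Γ) (F : Finset E) : ℤ :=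
  k * ((G.verts F).card : ℤ) - ℓ + beta α k G F

/-- `I` is `f_α`-sparse: `|F| ≤ f_α(F)` for every `F ∈ C(G)` with `F ⊆ I`. -/
def Sparse (α : Set Γ → ℤ) (k ℓ : ℤ) [DecidableEq V]
    (G : GainGraph V E Γ) (I : Finset E) : Prop :=
  ∀ F : Finset E, F ⊆ I → G.Connected F → (F.card : ℤ) ≤ fAlpha α k ℓ G F

/-- `F` is `f_α`-tight: connected, `f_α`-sparse, with `|F| = f_α(F)`. -/
def Tight (α : Set Γ → ℤ) (k ℓ : ℤ) [DecidableEq V]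
    (G : GainGraph V E Γ) (F : Finset E) : Prop :=
  G.Connected F ∧ Sparse α k ℓ G F ∧ (F.card : ℤ) = fAlpha α k ℓ G F

/-- An edge set `Y` is `f_α`-full: the subgraph `(V(Y), Y)` contains a spanning connected
`f_α`-sparse subgraph `G'` with `β(E(G')) = β(Y)` and
`|E(G')| ≥ k|V(G')| - ℓ + min{β(E(G')), 2k - ℓ + 1}`. -/
def Full (α : Set Γ → ℤ) (k ℓ : ℤ) [DecidableEq V]
    (G : GainGraph V E Γ) (Y : Finset E) : Prop :=
  ∃ E' : Finset E, E' ⊆ Y ∧ G.Connected E' ∧ G.verts E' = G.verts Y ∧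
    Sparse α k ℓ G E' ∧ beta α k G E' = beta α k G Y ∧
    k * ((G.verts E').card : ℤ) - ℓ + min (beta α k G E') (2 * k - ℓ + 1) ≤ (E'.card : ℤ)

/-- The graph `(G,ψ)` is `f_α`-full: it contains a spanning connected `f_α`-sparse
subgraph `G'` with `β(E(G')) = β(E(G))` and
`|E(G')| ≥ k|V(G')| - ℓ + min{β(E(G')), 2k - ℓ + 1}`. -/
def FullGraph [Fintype V] [Fintype E] [DecidableEq V]
    (α : Set Γ → ℤ) (k ℓ : ℤ) (G : GainGraph V E Γ) : Prop :=
  ∃ E' : Finset E, G.Connected E' ∧ G.verts E' = Finset.univ ∧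
    Sparse α k ℓ G E' ∧ beta α k G E' = beta α k G (Finset.univ : Finset E) ∧
    k * ((G.verts E').card : ℤ) - ℓ + min (beta α k G E') (2 * k - ℓ + 1) ≤ (E'.card : ℤ)

/-- `F` is `α`-critical: connected, near-balanced, and `α̃(F) > k`. -/
def AlphaCritical (α : Set Γ → ℤ) (k : ℤ) [DecidableEq V]
    (G : GainGraph V E Γ) (F : Finset E) : Prop :=
  G.Connected F ∧ G.NearBalanced F ∧ k < alphaTilde α G F

/-- Switching at `v` with `g`. -/
noncomputable def switch (G : GainGraph V E Γ) (v : V) (g : Γ) : GainGraph V E Γ where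
  tail := G.tail
  head := G.head
  gain e :=
    if G.tail e = v ∧ G.head e = v then g * G.gain e * g⁻¹
    else if G.tail e = v then g * G.gain e
    else if G.head e = v then G.gain e * g⁻¹
    else G.gain e

/-- Two gain functions (on the same underlying graph) are equivalent if one is obtained
from the other by a sequence of switchings. -/
def Equivalent (G G' : GainGraph V E Γ) : Prop :=
  Relation.ReflTransGen (fun H H' : GainGraph V E Γ => ∃ (v : V) (g : Γ), H' = H.switch v g) G G'

/-- The label of the edge `e`, re-oriented so that `e` is directed towards `v`. -/
noncomputable def orientTo (G : GainGraph V E Γ) (v : V) (e : E) : Γ :=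
  if G.head e = v then G.gain e else (G.gain e)⁻¹

/-- Adjacency in `G - v`. -/
def AdjAvoid (G : GainGraph V E Γ) (v u w : V) : Prop :=
  u ≠ v ∧ w ≠ v ∧ ∃ e : E, (G.tail e = u ∧ G.head e = w) ∨ (G.tail e = w ∧ G.head e = u)

/-- `S` is (the edge set of) a fraction of `v`: the subgraph of `G - L_v` induced by `v`
together with the vertex set of a connected component of `G - v`. -/
def IsFraction [Fintype E] (G : GainGraph V E Γ) (v : V) (S : Finset E) : Prop :=
  ∃ u : V, u ≠ v ∧
    S = Finset.univ.filter (fun e =>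
      ¬ (G.tail e = v ∧ G.head e = v) ∧
      (G.tail e = v ∨ Relation.ReflTransGen (G.AdjAvoid v) u (G.tail e)) ∧
      (G.head e = v ∨ Relation.ReflTransGen (G.AdjAvoid v) u (G.head e)))

/-- `I` is `(k,m)`-sparse: `|F| ≤ k|V(F)| - m` for every nonempty `F ⊆ I`. -/
def CountSparse [DecidableEq V] (G : GainGraph V E Γ) (k m : ℤ) (I : Finset E) : Prop :=
  ∀ F : Finset E, F ⊆ I → F.Nonempty → (F.card : ℤ) ≤ k * ((G.verts F).card : ℤ) - m

/-- `C` is a circuit of the `(k,m)`-count matroid `M_{k,m}(G)`: a minimal set that is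
not `(k,m)`-sparse. -/
def CountCircuit [DecidableEq V] (G : GainGraph V E Γ) (k m : ℤ) (C : Finset E) : Prop :=
  ¬ G.CountSparse k m C ∧ ∀ C' : Finset E, C' ⊆ C → C' ≠ C → G.CountSparse k m C'

end GainGraph

/-- `α : 2^Γ → ℤ` is polymatroidal. -/
structure Polymatroidal [Group Γ] (α : Set Γ → ℤ) : Prop where
  empty : α ∅ = 0
  submodular : ∀ X Y : Set Γ, α (X ∪ Y) + α (X ∩ Y) ≤ α X + α Y
  mono : ∀ X Y : Set Γ, X ⊆ Y → α X ≤ α Y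
  conj : ∀ (X : Set Γ) (γ : Γ), α ((fun x => γ * x * γ⁻¹) '' X) = α X
  clos : ∀ X : Set Γ, α ((Subgroup.closure X : Subgroup Γ) : Set Γ) = α X

/-- A polymatroidal function is normalized if `α({g}) ≠ 0` for every non-identity `g`
and `α({1}) = 0`. -/
def Normalized [Group Γ] (α : Set Γ → ℤ) : Prop :=
  (∀ g : Γ, g ≠ 1 → α {g} ≠ 0) ∧ α ({1} : Set Γ) = 0

/-- The smoothness condition: `α(S ∪ {g}) - α(S) > k` implies `S = {1}` and `g² ≠ 1`. -/
def Smooth [Group Γ] (α : Set Γ → ℤ) (k : ℤ) : Prop :=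
  ∀ (S : Set Γ) (g : Γ), S.Nonempty → k < α (S ∪ {g}) - α S →
    S = ({1} : Set Γ) ∧ g ^ 2 ≠ 1

section Submodular

variable {ι : Type*} [DecidableEq ι]

lemma union_sub_le_of_insert_sub_le {f : Finset ι → ℤ}
    (hf : ∀ A B : Finset ι, ∀ e, A ⊆ B → f (insert e B) - f B ≤ f (insert e A) - f A)
    {A B : Finset ι} (hAB : A ⊆ B) (S : Finset ι) :
    f (B ∪ S) - f B ≤ f (A ∪ S) - f A := by
  induction S using Finset.induction_on with
  | empty => simp
  | insert e S _ ih =>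
    have h := hf (A ∪ S) (B ∪ S) e (Finset.union_subset_union_left hAB)
    rw [Finset.union_insert, Finset.union_insert]
    linarith

lemma le_union_of_le_insert {f : Finset ι → ℤ} (hmono : ∀ A e, f A ≤ f (insert e A))
    (A S : Finset ι) : f A ≤ f (A ∪ S) := by
  induction S using Finset.induction_on with
  | empty => simp
  | insert a S _ ih => rw [Finset.union_insert]; exact ih.trans (hmono _ _)

/-- The matroid induced by a monotone submodular integer-valued function. -/
theorem exists_matroid_of_submodular [Finite ι] {f : Finset ι → ℤ} (h0 : f ∅ = 0)
    (hmono : ∀ A e, f A ≤ f (insert e A))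
    (hf : ∀ A B : Finset ι, ∀ e, A ⊆ B → f (insert e B) - f B ≤ f (insert e A) - f A) :
    ∃ M : Matroid ι, M.E = Set.univ ∧
      ∀ I : Finset ι, M.Indep (↑I) ↔ ∀ F ⊆ I, (F.card : ℤ) ≤ f F := by
  have hsub : ∀ A B, f (A ∪ B) + f (A ∩ B) ≤ f A + f B := fun A B ↦ by
    have h := union_sub_le_of_insert_sub_le hf (Finset.inter_subset_right (s₁ := A) (s₂ := B)) A
    rw [Finset.union_comm B A, Finset.union_eq_right.2 Finset.inter_subset_left] at h
    linarith
  have aug : ∀ ⦃I J : Finset ι⦄, (∀ F ⊆ I, (F.card : ℤ) ≤ f F) → (∀ F ⊆ J, (F.card : ℤ) ≤ f F) →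
      I.card < J.card → ∃ e ∈ J, e ∉ I ∧ ∀ F ⊆ insert e I, (F.card : ℤ) ≤ f F := by
    intro I J hI hJ hlt
    by_contra! hcon
    have key : ∀ S : Finset ι, S ⊆ J \ I → ∃ T ⊆ I, f T = T.card ∧ f (T ∪ S) = f T := by
      intro S
      induction S using Finset.induction_on with
      | empty => exact fun _ ↦ ⟨∅, by simp, by simp [h0], by simp⟩
      | insert e S _ ih =>
        intro hS
        obtain ⟨T, hTI, hT, hTS⟩ := ih ((Finset.subset_insert _ _).trans hS)
        have he := Finset.mem_sdiff.1 (hS (Finset.mem_insert_self e S))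
        obtain ⟨F, hF, hlt'⟩ := hcon e he.1 he.2
        have heF : e ∈ F := by
          by_contra h
          exact absurd (hI F ((Finset.subset_insert_iff_of_notMem h).1 hF)) (by lia)
        set U := F.erase e with hU
        have hUI : U ⊆ I := Finset.subset_insert_iff.1 hF
        have hUF : insert e U = F := Finset.insert_erase heF
        have hcard : U.card + 1 = F.card := Finset.card_erase_add_one heF
        have h1 := hI U hUI
        have h2 := hmono U e
        rw [hUF] at h2
        have hUt : f U = U.card := by lia
        have hUe : f (insert e U) = f U := by rw [hUF]; lia
        have h3 := hsub T U
        have h4 := hI _ (Finset.union_subset hTI hUI)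
        have h5 := hI _ ((Finset.inter_subset_left (s₁ := T) (s₂ := U)).trans hTI)
        have h6 := Finset.card_union_add_card_inter T U
        have hTU : f (T ∪ U) = (T ∪ U).card := by lia
        refine ⟨T ∪ U, Finset.union_subset hTI hUI, hTU, ?_⟩
        have h7 := union_sub_le_of_insert_sub_le hf
          (Finset.subset_union_left (s₁ := T) (s₂ := U)) S
        have h8 := hf U (T ∪ U ∪ S) e
          (Finset.subset_union_right.trans Finset.subset_union_left)
        have h9 := le_union_of_le_insert hmono (T ∪ U) (insert e S)
        rw [Finset.union_insert] at h9 ⊢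
        lia
    obtain ⟨T, hTI, hT, hTS⟩ := key (J \ I) subset_rfl
    have h1 := hJ (J ∩ T ∪ J \ I) (Finset.union_subset Finset.inter_subset_left
      Finset.sdiff_subset)
    have h2 := union_sub_le_of_insert_sub_le hf (Finset.inter_subset_right (s₁ := J) (s₂ := T))
      (J \ I)
    have h4 := le_union_of_le_insert hmono (J ∩ T ∪ J \ I) T
    have h5 : J ∩ T ∪ J \ I ∪ T = T ∪ J \ I := by
      ext x; simp only [Finset.mem_union, Finset.mem_inter, Finset.mem_sdiff]; tauto
    rw [h5] at h4
    have h6 : (J ∩ T ∪ J \ I).card = (J ∩ T).card + (J \ I).card :=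
      Finset.card_union_of_disjoint (Finset.disjoint_left.2 fun x hx hx' ↦
        (Finset.mem_sdiff.1 hx').2 (hTI (Finset.mem_inter.1 hx).2))
    have h7 := Finset.card_sdiff_add_card_inter J I
    have h8 := Finset.card_sdiff_add_card_inter T J
    have h9 : (T \ J).card ≤ (I \ J).card :=
      Finset.card_le_card (Finset.sdiff_subset_sdiff hTI subset_rfl)
    have h10 := Finset.card_sdiff_add_card_inter I J
    rw [Finset.inter_comm] at h8 h10
    lia
  refine ⟨(IndepMatroid.ofFinset Set.univ (fun I ↦ ∀ F ⊆ I, (F.card : ℤ) ≤ f F)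
    (by simp [h0]) (fun I J hJ hIJ F hF ↦ hJ F (hF.trans hIJ)) aug (by simp)).matroid, rfl,
    fun I ↦ ?_⟩
  rw [IndepMatroid.matroid_Indep, IndepMatroid.ofFinset_indep]

end Submodular

namespace GainGraph

lemma mem_verts_iff [DecidableEq V] {G : GainGraph V E Γ} {F : Finset E} {v : V} :
    v ∈ G.verts F ↔ ∃ a ∈ F, G.tail a = v ∨ G.head a = v := by
  simp only [verts, Finset.mem_union, Finset.mem_image]
  grind

section Walks

variable [Group Γ] {G : GainGraph V E Γ} {F F' : Set E} {u v w : V} {g h : Γ} {e : E}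

lemma GainWalk.mono (hF : F ⊆ F') (hw : G.GainWalk F u w g) : G.GainWalk F' u w g := by
  induction hw with
  | nil => exact .nil
  | fwd _ he ht ih => exact ih.fwd (hF he) ht
  | bwd _ he ht ih => exact ih.bwd (hF he) ht

lemma GainWalk.trans (h₁ : G.GainWalk F u v g) (h₂ : G.GainWalk F v w h) :
    G.GainWalk F u w (g * h) := by
  induction h₂ with
  | nil => simpa using h₁
  | fwd _ he ht ih => rw [← mul_assoc]; exact ih.fwd he ht
  | bwd _ he ht ih => rw [← mul_assoc]; exact ih.bwd he ht

lemma GainWalk.of_mem (he : e ∈ F) : G.GainWalk F (G.tail e) (G.head e) (G.gain e) := by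
  simpa using (GainWalk.nil (G := G) (F := F)).fwd he rfl

lemma GainWalk.of_mem_inv (he : e ∈ F) :
    G.GainWalk F (G.head e) (G.tail e) (G.gain e)⁻¹ := by
  simpa using (GainWalk.nil (G := G) (F := F)).bwd he rfl

lemma GainWalk.symm (hw : G.GainWalk F u w g) : G.GainWalk F w u g⁻¹ := by
  induction hw with
  | nil => simpa using GainWalk.nil
  | fwd _ he ht ih =>
    subst ht
    rw [mul_inv_rev]
    exact (GainWalk.of_mem_inv he).trans ih
  | @bwd _ _ e _ he ht ih =>
    subst ht
    rw [mul_inv_rev, inv_inv]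
    exact (GainWalk.of_mem he).trans ih

/-- `u` and `w` lie in the same connected component of `(V, F)`. -/
def Reach (G : GainGraph V E Γ) (F : Set E) (u w : V) : Prop :=
  ∃ g, G.GainWalk F u w g

lemma Reach.refl (u : V) : G.Reach F u u := ⟨(1 : Γ), .nil⟩

lemma Reach.symm (h : G.Reach F u w) : G.Reach F w u :=
  h.elim fun _ h ↦ ⟨_, GainWalk.symm h⟩

lemma Reach.trans (h₁ : G.Reach F u v) (h₂ : G.Reach F v w) : G.Reach F u w :=
  h₁.elim fun _ h₁ ↦ h₂.elim fun _ h₂ ↦ ⟨_, h₁.trans h₂⟩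

lemma Reach.mono (hF : F ⊆ F') (h : G.Reach F u w) : G.Reach F' u w :=
  h.elim fun _ h ↦ ⟨_, h.mono hF⟩

lemma Reach.of_mem (he : e ∈ F) : G.Reach F (G.tail e) (G.head e) :=
  ⟨_, GainWalk.of_mem he⟩

lemma Reach.insert_cases (h : G.Reach (insert e F) u w) :
    G.Reach F u w ∨ (G.Reach F u (G.tail e) ∧ G.Reach F (G.head e) w) ∨
      (G.Reach F u (G.head e) ∧ G.Reach F (G.tail e) w) := by
  obtain ⟨g, hw⟩ := h
  induction hw with
  | nil => exact .inl (.refl u)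
  | @fwd w g a _ ha ht ih =>
    subst ht
    obtain rfl | ha := ha
    · obtain h | ⟨h, _⟩ | ⟨h, _⟩ := ih
      · exact .inr (.inl ⟨h, .refl _⟩)
      · exact .inr (.inl ⟨h, .refl _⟩)
      · exact .inl h
    · have := Reach.of_mem (G := G) ha
      obtain h | ⟨h, h'⟩ | ⟨h, h'⟩ := ih
      · exact .inl (h.trans this)
      · exact .inr (.inl ⟨h, h'.trans this⟩)
      · exact .inr (.inr ⟨h, h'.trans this⟩)
  | @bwd w g a _ ha ht ih =>
    subst ht
    obtain rfl | ha := ha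
    · obtain h | ⟨h, _⟩ | ⟨h, _⟩ := ih
      · exact .inr (.inr ⟨h, .refl _⟩)
      · exact .inl h
      · exact .inr (.inr ⟨h, .refl _⟩)
    · have := (Reach.of_mem (G := G) ha).symm
      obtain h | ⟨h, h'⟩ | ⟨h, h'⟩ := ih
      · exact .inl (h.trans this)
      · exact .inr (.inl ⟨h, h'.trans this⟩)
      · exact .inr (.inr ⟨h, h'.trans this⟩)

lemma gains_mono (hF : F ⊆ F') : G.gains F u ⊆ G.gains F' u := fun _ h ↦ GainWalk.mono hF h

lemma gains_eq_conj (hw : G.GainWalk F u w h) :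
    G.gains F u = (fun x ↦ h * x * h⁻¹) '' G.gains F w := by
  ext g
  refine ⟨fun hg ↦ ⟨h⁻¹ * g * h, (hw.symm.trans hg).trans hw, by group⟩, ?_⟩
  rintro ⟨x, hx, rfl⟩
  exact (hw.trans hx).trans hw.symm

/-- The value of `α` on the component of `u` in `(V, F)`. -/
def compValue (α : Set Γ → ℤ) (G : GainGraph V E Γ) (F : Set E) (u : V) : ℤ :=
  α (G.gains F u)

lemma compValue_eq_of_reach {α : Set Γ → ℤ} (hα : Polymatroidal α) (h : G.Reach F u w) :
    compValue α G F u = compValue α G F w := by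
  obtain ⟨h, hw⟩ := h
  rw [compValue, gains_eq_conj hw, hα.conj, compValue]

lemma compValue_mono {α : Set Γ → ℤ} (hα : Polymatroidal α) (hF : F ⊆ F') (u : V) :
    compValue α G F u ≤ compValue α G F' u :=
  hα.mono _ _ (gains_mono hF)

/-- Edges outside the component of `u` do not affect its walks. -/
lemma GainWalk.restrict (hF : ∀ a ∈ F', G.Reach F u (G.tail a) ∨ G.Reach F u (G.head a) → a ∈ F)
    (hw : G.GainWalk F' u w g) : G.GainWalk F u w g := by
  induction hw with
  | nil => exact .nil
  | fwd _ ha ht ih =>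
    subst ht
    exact ih.fwd (hF _ ha (.inl ⟨_, ih⟩)) rfl
  | bwd _ ha ht ih =>
    subst ht
    exact ih.bwd (hF _ ha (.inr ⟨_, ih⟩)) rfl

lemma gains_insert_of_not_reach (ht : ¬ G.Reach F u (G.tail e)) (hh : ¬ G.Reach F u (G.head e)) :
    G.gains (insert e F) u = G.gains F u := by
  refine Set.Subset.antisymm (fun g hg ↦ GainWalk.restrict ?_ hg)
    (gains_mono (Set.subset_insert _ _))
  rintro a (rfl | ha) h
  · tauto
  · exact ha

/-- Closed walks at the tail of a new edge `e` lie in every subgroup containing the old closed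
walks at both ends (transported along `e`) and the closed walks traversing `e` once. -/
lemma gains_insert_subset (K : Subgroup Γ) (hA : G.gains F (G.tail e) ⊆ K)
    (hB : ∀ g ∈ G.gains F (G.head e), G.gain e * g * (G.gain e)⁻¹ ∈ K)
    (hP : ∀ p, G.GainWalk F (G.head e) (G.tail e) p → G.gain e * p ∈ K) :
    G.gains (insert e F) (G.tail e) ⊆ K := by
  have key : ∀ w g, G.GainWalk (insert e F) (G.tail e) w g →
      (∃ g', G.GainWalk F (G.tail e) w g' ∧ g * g'⁻¹ ∈ K) ∨
      (∃ g', G.GainWalk F (G.head e) w g' ∧ g * g'⁻¹ * (G.gain e)⁻¹ ∈ K) := by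
    intro w g hw
    induction hw with
    | nil => exact .inl ⟨1, .nil, by simp⟩
    | @fwd w g a _ ha ht ih =>
      subst ht
      obtain rfl | ha := ha
      · refine .inr ⟨1, .nil, ?_⟩
        obtain ⟨g', hw, hg⟩ | ⟨g', hw, hg⟩ := ih
        · simpa using K.mul_mem hg (hA hw)
        · simpa [mul_assoc] using K.mul_mem hg (hP _ hw)
      · obtain ⟨g', hw, hg⟩ | ⟨g', hw, hg⟩ := ih
        · exact .inl ⟨_, hw.fwd ha rfl, by simpa [mul_assoc] using hg⟩
        · exact .inr ⟨_, hw.fwd ha rfl, by simpa [mul_assoc] using hg⟩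
    | @bwd w g a _ ha ht ih =>
      subst ht
      obtain rfl | ha := ha
      · refine .inl ⟨1, .nil, ?_⟩
        obtain ⟨g', hw, hg⟩ | ⟨g', hw, hg⟩ := ih
        · simpa [mul_assoc] using K.mul_mem hg (K.inv_mem (hP _ hw.symm))
        · simpa [mul_assoc] using K.mul_mem hg (hB _ hw)
      · obtain ⟨g', hw, hg⟩ | ⟨g', hw, hg⟩ := ih
        · exact .inl ⟨_, hw.bwd ha rfl, by simpa [mul_assoc] using hg⟩
        · exact .inr ⟨_, hw.bwd ha rfl, by simpa [mul_assoc] using hg⟩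
  intro g hg
  obtain ⟨g', hw, hg⟩ | ⟨g', hw, hg⟩ := key _ _ hg
  · simpa using K.mul_mem hg (hA hw)
  · simpa [mul_assoc] using K.mul_mem hg (hP _ hw)

lemma conj_mem_gains_insert (hg : g ∈ G.gains F (G.head e)) :
    G.gain e * g * (G.gain e)⁻¹ ∈ G.gains (insert e F) (G.tail e) :=
  ((GainWalk.of_mem (Set.mem_insert _ _)).trans (hg.mono (Set.subset_insert _ _))).trans
    (GainWalk.of_mem_inv (Set.mem_insert _ _))

lemma gains_insert_subset_closure_of_reach (hF : F ⊆ F') (hr : G.Reach F (G.tail e) (G.head e)) :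
    G.gains (insert e F') (G.tail e) ⊆
      Subgroup.closure (G.gains F' (G.tail e) ∪ G.gains (insert e F) (G.tail e)) := by
  obtain ⟨q, hq⟩ := hr.symm
  set K := Subgroup.closure (G.gains F' (G.tail e) ∪ G.gains (insert e F) (G.tail e))
  have hA : ∀ g ∈ G.gains F' (G.tail e), g ∈ K := fun g hg ↦
    Subgroup.subset_closure (.inl hg)
  have hc : G.gain e * q ∈ K := Subgroup.subset_closure (.inr
    ((GainWalk.of_mem (Set.mem_insert _ _)).trans (hq.mono (Set.subset_insert _ _))))
  have hq' := hq.mono hF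
  refine gains_insert_subset K hA (fun g hg ↦ ?_) (fun p hp ↦ ?_)
  · have := K.mul_mem (K.mul_mem hc (hA _ ((hq'.symm.trans hg).trans hq'))) (K.inv_mem hc)
    simpa [mul_assoc] using this
  · have := K.mul_mem hc (hA _ (hq'.symm.trans hp))
    simpa [mul_assoc] using this

lemma compValue_insert_of_reach {α : Set Γ → ℤ} (hα : Polymatroidal α) (hF : F ⊆ F')
    (hr : G.Reach F (G.tail e) (G.head e)) :
    compValue α G (insert e F') (G.tail e) + compValue α G F (G.tail e) ≤
      compValue α G F' (G.tail e) + compValue α G (insert e F) (G.tail e) := by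
  have h₁ := hα.mono _ _ (gains_insert_subset_closure_of_reach hF hr)
  rw [hα.clos] at h₁
  have h₂ := hα.mono _ _ (Set.subset_inter (gains_mono (G := G) (u := G.tail e) hF)
    (gains_mono (G := G) (u := G.tail e) (Set.subset_insert e F)))
  have h₃ := hα.submodular (G.gains F' (G.tail e)) (G.gains (insert e F) (G.tail e))
  simp only [compValue]
  lia

lemma compValue_insert_of_not_reach {α : Set Γ → ℤ} (hα : Polymatroidal α) (hF : F ⊆ F')
    (hr : ¬ G.Reach F' (G.tail e) (G.head e)) :
    compValue α G (insert e F') (G.tail e) + compValue α G F (G.tail e)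
        + compValue α G F (G.head e) ≤
      compValue α G F' (G.tail e) + compValue α G F' (G.head e)
        + compValue α G (insert e F) (G.tail e) := by
  set A := G.gains F (G.tail e)
  set A' := G.gains F' (G.tail e)
  set B := (fun x ↦ G.gain e * x * (G.gain e)⁻¹) '' G.gains F (G.head e) with hB
  set B' := (fun x ↦ G.gain e * x * (G.gain e)⁻¹) '' G.gains F' (G.head e) with hB'
  have hAA : A ⊆ A' := gains_mono hF
  have hBB : B ⊆ B' := Set.image_mono (gains_mono hF)
  have hY' : G.gains (insert e F') (G.tail e) ⊆ Subgroup.closure (A' ∪ B') :=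
    gains_insert_subset _ (fun g hg ↦ Subgroup.subset_closure (.inl hg))
      (fun g hg ↦ Subgroup.subset_closure (.inr ⟨g, hg, rfl⟩))
      (fun p hp ↦ absurd (Reach.symm ⟨p, hp⟩) hr)
  have hY : A ∪ B ⊆ G.gains (insert e F) (G.tail e) := by
    rintro _ (hg | ⟨g, hg, rfl⟩)
    · exact gains_mono (Set.subset_insert _ _) hg
    · exact conj_mem_gains_insert hg
  have h₁ := hα.mono _ _ hY'
  rw [hα.clos] at h₁
  have h₂ := hα.mono _ _ hY
  have h₃ := hα.submodular A' (A ∪ B)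
  have h₄ := hα.mono A (A' ∩ (A ∪ B)) (Set.subset_inter hAA Set.subset_union_left)
  rw [← Set.union_assoc, Set.union_eq_left.2 hAA] at h₃
  have h₅ := hα.submodular (A' ∪ B) B'
  have h₆ := hα.mono B ((A' ∪ B) ∩ B') (Set.subset_inter Set.subset_union_right hBB)
  rw [Set.union_assoc, Set.union_eq_right.2 hBB] at h₅
  have h₇ : α B = compValue α G F (G.head e) := hα.conj _ _
  have h₈ : α B' = compValue α G F' (G.head e) := hα.conj _ _
  rw [← h₇, ← h₈]
  simp only [compValue]
  lia

lemma Polymatroidal.one {α : Set Γ → ℤ} (hα : Polymatroidal α) : α {1} = 0 := by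
  rw [← hα.empty, ← hα.clos ∅, Subgroup.closure_empty, Subgroup.coe_bot]

lemma GainWalk.isolated (h : ∀ a ∈ F, G.tail a ≠ u ∧ G.head a ≠ u)
    (hw : G.GainWalk F u w g) : w = u ∧ g = 1 := by
  induction hw with
  | nil => exact ⟨rfl, rfl⟩
  | fwd _ ha ht ih => exact absurd (ht.trans ih.1) (h _ ha).1
  | bwd _ ha ht ih => exact absurd (ht.trans ih.1) (h _ ha).2

lemma compValue_isolated {α : Set Γ → ℤ} (hα : Polymatroidal α) (h : ∀ a ∈ F, G.tail a ≠ u ∧ G.head a ≠ u) :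
    compValue α G F u = 0 := by
  have : G.gains F u = {1} := by
    ext g
    exact ⟨fun hg ↦ (GainWalk.isolated h hg).2, fun hg ↦ hg ▸ GainWalk.nil⟩
  rw [compValue, this, Polymatroidal.one hα]

end Walks

section CountRank

variable [Group Γ] {G : GainGraph V E Γ} {F F' : Set E} {u v w : V} {e : E}
  {α : Set Γ → ℤ} {k : ℤ}

/-- The partition of the vertices into the connected components of `(V, F)`. -/
def reachSetoid (G : GainGraph V E Γ) (F : Set E) : Setoid V where
  r := G.Reach F
  iseqv := ⟨.refl, .symm, .trans⟩

lemma reach_out (u : V) :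
    G.Reach F u (Quotient.mk (G.reachSetoid F) u).out :=
  Reach.symm (Quotient.mk_out (s := G.reachSetoid F) u)

/-- `R` contains exactly one vertex of each connected component of `(V, F)`. -/
def IsTransversal (G : GainGraph V E Γ) (F : Set E) (R : Finset V) : Prop :=
  ∀ u, ∃! r, r ∈ R ∧ G.Reach F u r

lemma IsTransversal.eq {R : Finset V} (hR : G.IsTransversal F R) (hu : u ∈ R) (hv : v ∈ R)
    (h : G.Reach F u v) : u = v :=
  (hR u).unique ⟨hu, .refl u⟩ ⟨hv, h⟩

lemma exists_alphaTilde_eq [DecidableEq V] {F : Finset E} (hF : F.Nonempty) :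
    ∃ u ∈ G.verts F, alphaTilde α G F = compValue α G (F : Set E) u :=
  ⟨G.tail hF.choose, mem_verts_iff.2 ⟨_, hF.choose_spec, .inl rfl⟩, dif_pos hF⟩

/-- The edges of `F` in the component of `u` form a connected set on that component. -/
lemma connected_filter_reach [DecidableEq V] {F : Finset E} {u : V}
    (hne : (F.filter fun a ↦ G.Reach (F : Set E) u (G.tail a)).Nonempty) :
    G.Connected (F.filter fun a ↦ G.Reach (F : Set E) u (G.tail a)) := by
  set F' := F.filter fun a ↦ G.Reach (F : Set E) u (G.tail a) with hF'
  have hv : ∀ v, G.Reach (F : Set E) u v → G.Reach (F' : Set E) u v := by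
    rintro v ⟨g, hw⟩
    induction hw with
    | nil => exact .refl _
    | @fwd w _ a hw ha ht ih =>
      subst ht
      exact ih.trans (.of_mem (by simpa [hF'] using ⟨ha, _, hw⟩))
    | @bwd w _ a hw ha ht ih =>
      subst ht
      exact ih.trans (Reach.of_mem (by
        simpa [hF'] using ⟨ha, Reach.trans ⟨_, hw⟩ (Reach.of_mem ha).symm⟩)).symm
  have hv' : ∀ v ∈ G.verts F', G.Reach (F' : Set E) u v := by
    intro v hv''
    obtain ⟨a, ha, rfl | rfl⟩ := mem_verts_iff.1 hv''
    · exact hv _ (Finset.mem_filter.1 ha).2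
    · exact hv _ ((Finset.mem_filter.1 ha).2.trans (.of_mem (Finset.mem_filter.1 ha).1))
  exact ⟨hne, fun a ha b hb ↦ (hv' a ha).symm.trans (hv' b hb)⟩

variable [Fintype V]

/-- The extension of the count function to all edge sets, as a sum over the connected
components of `(V, F)`, including isolated vertices. -/
noncomputable def countRank (α : Set Γ → ℤ) (k : ℤ) (G : GainGraph V E Γ) (F : Set E) : ℤ :=
  k * Fintype.card V - ∑ q : Quotient (G.reachSetoid F), (k - compValue α G F q.out)

lemma exists_isTransversal (G : GainGraph V E Γ) (F : Set E) : ∃ R, G.IsTransversal F R := by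
  refine ⟨Finset.univ.image (Quotient.out : Quotient (G.reachSetoid F) → V), fun u ↦
    ⟨(Quotient.mk (G.reachSetoid F) u).out, ⟨by simp, reach_out u⟩, ?_⟩⟩
  rintro r ⟨hr, hur⟩
  obtain ⟨q, -, rfl⟩ := Finset.mem_image.1 hr
  rw [Quotient.sound (s := G.reachSetoid F) hur, Quotient.out_eq]

lemma countRank_eq_of_isTransversal (hα : Polymatroidal α) {R : Finset V}
    (hR : G.IsTransversal F R) :
    countRank α k G F = k * Fintype.card V - ∑ r ∈ R, (k - compValue α G F r) := by
  rw [countRank]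
  congr 1
  symm
  refine Finset.sum_bij (fun r _ ↦ Quotient.mk (G.reachSetoid F) r) (by simp)
    (fun r hr s hs h ↦ hR.eq hr hs (Quotient.exact h)) (fun q _ ↦ ?_) (fun r _ ↦ ?_)
  · obtain ⟨r, ⟨hr, h⟩, -⟩ := hR q.out
    exact ⟨r, hr, by rw [← Quotient.sound (s := G.reachSetoid F) h, Quotient.out_eq]⟩
  · rw [compValue_eq_of_reach hα (reach_out r)]

lemma countRank_insert_of_reach (hα : Polymatroidal α)
    (hr : G.Reach F (G.tail e) (G.head e)) :
    countRank α k G (insert e F) =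
      countRank α k G F + compValue α G (insert e F) (G.tail e) - compValue α G F (G.tail e) := by
  have hreach : ∀ u w, G.Reach (insert e F) u w ↔ G.Reach F u w := fun u w ↦
    ⟨fun h ↦ by
      obtain h | ⟨h, h'⟩ | ⟨h, h'⟩ := h.insert_cases
      · exact h
      · exact (h.trans hr).trans h'
      · exact (h.trans hr.symm).trans h', Reach.mono (Set.subset_insert _ _)⟩
  obtain ⟨R, hR⟩ := exists_isTransversal G F
  have hR' : G.IsTransversal (insert e F) R := fun u ↦ by simpa only [hreach] using hR u
  obtain ⟨t, ⟨htR, ht⟩, -⟩ := hR (G.tail e)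
  have hrest : ∀ r ∈ R.erase t,
      k - compValue α G (insert e F) r = k - compValue α G F r := fun r hrR ↦ by
    have hrt : ¬ G.Reach F r (G.tail e) := fun h ↦
      Finset.ne_of_mem_erase hrR (hR.eq (Finset.mem_of_mem_erase hrR) htR (h.trans ht))
    rw [compValue, gains_insert_of_not_reach hrt fun h ↦ hrt (h.trans hr.symm), compValue]
  rw [countRank_eq_of_isTransversal hα hR, countRank_eq_of_isTransversal hα hR',
    ← Finset.add_sum_erase R _ htR, ← Finset.add_sum_erase R _ htR, Finset.sum_congr rfl hrest,
    compValue_eq_of_reach hα ht, compValue_eq_of_reach hα ((hreach _ _).2 ht)]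
  ring

lemma countRank_insert_of_not_reach (hα : Polymatroidal α)
    (hr : ¬ G.Reach F (G.tail e) (G.head e)) :
    countRank α k G (insert e F) =
      countRank α k G F + k + compValue α G (insert e F) (G.tail e)
        - compValue α G F (G.tail e) - compValue α G F (G.head e) := by
  obtain ⟨R, hR⟩ := exists_isTransversal G F
  obtain ⟨t, ⟨htR, ht⟩, -⟩ := hR (G.tail e)
  obtain ⟨h, ⟨hhR, hh⟩, -⟩ := hR (G.head e)
  have hth : t ≠ h := fun hth ↦ hr (ht.trans (hth ▸ hh.symm))
  have htR' : t ∈ R.erase h := Finset.mem_erase.2 ⟨hth, htR⟩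
  have hsub := Set.subset_insert e F
  have he : G.Reach (insert e F) (G.tail e) (G.head e) := .of_mem (Set.mem_insert _ _)
  have hR' : G.IsTransversal (insert e F) (R.erase h) := by
    intro u
    obtain ⟨r, ⟨hrR, hur⟩, -⟩ := hR u
    have hex : ∃ r ∈ R.erase h, G.Reach (insert e F) u r := by
      by_cases hrh : r = h
      · subst hrh
        exact ⟨t, htR', ((hur.trans hh.symm).mono hsub).trans (he.symm.trans (ht.mono hsub))⟩
      · exact ⟨r, Finset.mem_erase.2 ⟨hrh, hrR⟩, hur.mono hsub⟩
    have huniq : ∀ a ∈ R.erase h, ∀ b ∈ R.erase h, G.Reach (insert e F) a b → a = b := by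
      intro a ha b hb hab
      rw [Finset.mem_erase] at ha hb
      obtain h' | ⟨_, h'⟩ | ⟨h', _⟩ := hab.insert_cases
      · exact hR.eq ha.2 hb.2 h'
      · exact absurd (hR.eq hb.2 hhR (h'.symm.trans hh)) hb.1
      · exact absurd (hR.eq ha.2 hhR (h'.trans hh)) ha.1
    obtain ⟨s, hs, hus⟩ := hex
    exact ⟨s, ⟨hs, hus⟩, fun y hy ↦ huniq y hy.1 s hs (hy.2.symm.trans hus)⟩
  have hrest : ∀ r ∈ (R.erase h).erase t,
      k - compValue α G (insert e F) r = k - compValue α G F r := fun r hrR ↦ by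
    simp only [Finset.mem_erase] at hrR
    rw [compValue, gains_insert_of_not_reach (fun h' ↦ hrR.1 (hR.eq hrR.2.2 htR (h'.trans ht)))
      (fun h' ↦ hrR.2.1 (hR.eq hrR.2.2 hhR (h'.trans hh))), compValue]
  rw [countRank_eq_of_isTransversal hα hR, countRank_eq_of_isTransversal hα hR',
    ← Finset.add_sum_erase R _ hhR, ← Finset.add_sum_erase _ _ htR',
    ← Finset.add_sum_erase (R.erase h) _ htR', Finset.sum_congr rfl hrest,
    compValue_eq_of_reach hα ht, compValue_eq_of_reach hα hh,
    compValue_eq_of_reach hα (ht.mono hsub)]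
  ring

lemma countRank_le_insert (hα : Polymatroidal α) (hk : ∀ X, α X ≤ k) (F : Set E) (e : E) :
    countRank α k G F ≤ countRank α k G (insert e F) := by
  have h₁ := compValue_mono (G := G) hα (Set.subset_insert e F) (G.tail e)
  by_cases hr : G.Reach F (G.tail e) (G.head e)
  · rw [countRank_insert_of_reach hα hr]
    lia
  · rw [countRank_insert_of_not_reach hα hr]
    have : compValue α G F (G.head e) ≤ k := hk _
    lia

lemma countRank_insert_sub_le (hα : Polymatroidal α) (hk : ∀ X, α X ≤ k) (hF : F ⊆ F') (e : E) :
    countRank α k G (insert e F') - countRank α k G F' ≤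
      countRank α k G (insert e F) - countRank α k G F := by
  by_cases hr : G.Reach F (G.tail e) (G.head e)
  · rw [countRank_insert_of_reach hα hr, countRank_insert_of_reach hα (hr.mono hF)]
    have := compValue_insert_of_reach hα hF hr
    lia
  by_cases hr' : G.Reach F' (G.tail e) (G.head e)
  · rw [countRank_insert_of_not_reach hα hr, countRank_insert_of_reach hα hr']
    have h₁ := compValue_mono (G := G) hα (Set.subset_insert e F) (G.tail e)
    have h₂ := compValue_mono (G := G) hα hF (G.head e)
    rw [← compValue_eq_of_reach hα hr'] at h₂
    have h₃ : compValue α G (insert e F') (G.tail e) ≤ k := hk _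
    lia
  · rw [countRank_insert_of_not_reach hα hr, countRank_insert_of_not_reach hα hr']
    have := compValue_insert_of_not_reach hα hF hr'
    lia

lemma countRank_empty (hα : Polymatroidal α) : countRank α k G (∅ : Set E) = 0 := by
  have hR : G.IsTransversal (∅ : Set E) Finset.univ := fun u ↦
    ⟨u, ⟨Finset.mem_univ _, .refl u⟩, fun w hw ↦ hw.2.elim fun _ h ↦ (h.isolated (by simp)).1⟩
  rw [countRank_eq_of_isTransversal hα hR,
    Finset.sum_congr rfl fun u _ ↦ by rw [compValue_isolated hα (by simp)]]
  simp [mul_comm]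

variable [DecidableEq V]

lemma countRank_of_connected (hα : Polymatroidal α) {F : Finset E} (hF : G.Connected F) :
    countRank α k G (F : Set E) = k * (G.verts F).card - k + alphaTilde α G F := by
  obtain ⟨u₀, hu₀, hα₀⟩ := exists_alphaTilde_eq (G := G) (α := α) hF.1
  have hiso : ∀ u ∉ G.verts F, ∀ a ∈ (F : Set E), G.tail a ≠ u ∧ G.head a ≠ u := by
    intro u hu a ha
    refine ⟨fun h ↦ hu ?_, fun h ↦ hu ?_⟩ <;> exact mem_verts_iff.2 ⟨a, ha, by tauto⟩
  have hR : G.IsTransversal (F : Set E) (insert u₀ (G.verts F)ᶜ) := by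
    intro u
    by_cases hu : u ∈ G.verts F
    · refine ⟨u₀, ⟨Finset.mem_insert_self _ _, hF.2 u hu u₀ hu₀⟩, fun r ⟨hr, hur⟩ ↦ ?_⟩
      obtain rfl | hr := Finset.mem_insert.1 hr
      · rfl
      · rw [Finset.mem_compl] at hr
        obtain ⟨_, hw⟩ := hur.symm
        exact absurd hu ((hw.isolated (hiso r hr)).1 ▸ hr)
    · exact ⟨u, ⟨by simp [hu], .refl u⟩, fun r ⟨_, _, hw⟩ ↦ (hw.isolated (hiso u hu)).1⟩
  rw [countRank_eq_of_isTransversal hα hR, Finset.sum_insert (by simpa using hu₀),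
    Finset.sum_congr rfl fun u hu ↦ by
      rw [compValue_isolated hα (hiso u (Finset.mem_compl.1 hu))], ← hα₀,
    ← Finset.card_add_card_compl (G.verts F)]
  simp only [sub_zero, Finset.sum_const, nsmul_eq_mul]
  push_cast
  ring

lemma card_le_countRank (hα : Polymatroidal α) (hk : 0 ≤ k) (h0 : ∀ X, 0 ≤ α X) {F : Finset E}
    (h : ∀ F' ⊆ F, G.Connected F' →
      (F'.card : ℤ) ≤ k * (G.verts F').card - k + alphaTilde α G F') :
    (F.card : ℤ) ≤ countRank α k G (F : Set E) := by
  set π := Quotient.mk (G.reachSetoid (F : Set E))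
  have hπ : ∀ (q : Quotient (G.reachSetoid (F : Set E))) v,
      π v = q ↔ G.Reach (F : Set E) q.out v := fun q v ↦ by
    rw [← Quotient.out_eq q, Quotient.eq, Quotient.out_eq]
    exact ⟨Reach.symm, Reach.symm⟩
  have hE := Finset.card_eq_sum_card_fiberwise (s := F) (f := fun a ↦ π (G.tail a))
    (t := Finset.univ) (by simp)
  have hV := Finset.card_eq_sum_card_fiberwise (s := (Finset.univ : Finset V)) (f := π)
    (t := Finset.univ) (by simp)
  rw [countRank, ← Finset.card_univ, hV, hE]
  push_cast
  rw [Finset.mul_sum, ← Finset.sum_sub_distrib]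
  refine Finset.sum_le_sum fun q _ ↦ ?_
  simp only [hπ]
  set F' := F.filter fun a ↦ G.Reach (F : Set E) q.out (G.tail a) with hF'
  set C := Finset.univ.filter fun v ↦ G.Reach (F : Set E) q.out v with hC
  obtain hemp | hne := F'.eq_empty_or_nonempty
  · have hpos : 0 < C.card := Finset.card_pos.2 ⟨q.out, by simp [hC, Reach.refl]⟩
    have h0' : 0 ≤ compValue α G (F : Set E) q.out := h0 _
    rw [hemp, Finset.card_empty]
    push_cast
    nlinarith
  · have hcon := connected_filter_reach hne
    have hsub : F' ⊆ F := Finset.filter_subset _ _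
    have hverts : G.verts F' ⊆ C := by
      intro v hv
      obtain ⟨a, ha, rfl | rfl⟩ := mem_verts_iff.1 hv
      · simpa [hC] using (Finset.mem_filter.1 ha).2
      · simpa [hC] using (Finset.mem_filter.1 ha).2.trans (.of_mem (Finset.mem_filter.1 ha).1)
    have h₁ := h F' hsub hcon
    obtain ⟨u, hu, hu'⟩ := exists_alphaTilde_eq (G := G) (α := α) hne
    have h₂ := compValue_mono (G := G) hα (Finset.coe_subset.2 hsub) u
    rw [← hu', ← compValue_eq_of_reach hα (Finset.mem_filter.1 (hverts hu)).2] at h₂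
    have h₃ : ((G.verts F').card : ℤ) ≤ C.card := by exact_mod_cast Finset.card_le_card hverts
    have h₄ := mul_le_mul_of_nonneg_left h₃ hk
    linarith

end CountRank

end GainGraph

/-- Theorem 1, Tanigawa: for a polymatroidal `α : 2^Γ → {0,…,k}`,
the count condition `|F| ≤ k|V(F)| - k + α̃(F)` for all connected `F ⊆ I`
defines the independent sets of a matroid on `E`. -/
theorem statement0 {V E Γ : Type} [Fintype V] [DecidableEq V] [Fintype E] [DecidableEq E]
    [Group Γ] (G : GainGraph V E Γ) (k : ℤ) (hk : 1 ≤ k)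
    (α : Set Γ → ℤ) (hpoly : Polymatroidal α)
    (hrange : ∀ X : Set Γ, 0 ≤ α X ∧ α X ≤ k) :
    ∃ M : Matroid E, M.E = Set.univ ∧
      ∀ I : Finset E, M.Indep (↑I) ↔
        ∀ F : Finset E, F ⊆ I → G.Connected F →
          (F.card : ℤ) ≤ k * ((G.verts F).card : ℤ) - k + GainGraph.alphaTilde α G F := by
  obtain ⟨M, hE, hM⟩ := exists_matroid_of_submodular
    (f := fun F : Finset E ↦ GainGraph.countRank α k G (F : Set E))
    (by simpa using GainGraph.countRank_empty hpoly)
    (fun A e ↦ by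
      rw [Finset.coe_insert]
      exact GainGraph.countRank_le_insert hpoly (fun X ↦ (hrange X).2) _ e)
    (fun A B e hAB ↦ by
      rw [Finset.coe_insert, Finset.coe_insert]
      exact GainGraph.countRank_insert_sub_le hpoly (fun X ↦ (hrange X).2)
        (Finset.coe_subset.2 hAB) e)
  refine ⟨M, hE, fun I ↦ (hM I).trans ⟨fun h F hF hcon ↦ ?_, fun h F hF ↦ ?_⟩⟩
  · exact (h F hF).trans_eq (GainGraph.countRank_of_connected hpoly hcon)
  · exact GainGraph.card_le_countRank hpoly (by lia) (fun X ↦ (hrange X).1)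
      fun F' hF' ↦ h F' (hF'.trans hF)

end CountMatroidPaper
end

section
/- Let k, ℓ be integers with k ≥ 1 and 0 ≤ ℓ ≤ k+1, Γ a group, and α: 2^Γ → {0,1,…,ℓ} a normalized polymatroidal function. Then α satisfies the smoothness condition if and only if α(Γ') ≤ k for every subgroup Γ' of Γ isomorphic to ℤ₂. -/
/- Formalization of count matroids of group-labeled graphs. -/

namespace CountMatroidPaper

attribute [local instance] Classical.propDecidable

variable {V E Γ : Type*}

/-- A subgroup isomorphic to `ℤ₂` consists of the identity and one involution. -/
theorem exists_involution_of_mulEquiv_zmod_two {Γ : Type*} [Group Γ] (H : Subgroup Γ)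
    (e : H ≃* Multiplicative (ZMod 2)) :
    ∃ g : Γ, g ^ 2 = 1 ∧ (H : Set Γ) ⊆ {1} ∪ {g} := by
  have key : ∀ a : Multiplicative (ZMod 2), a = 1 ∨ a = Multiplicative.ofAdd 1 := by decide
  refine ⟨e.symm (Multiplicative.ofAdd 1), ?_, fun x hx => ?_⟩
  · have h : (e.symm (Multiplicative.ofAdd 1)) ^ 2 = 1 := by
      rw [← map_pow, show (Multiplicative.ofAdd (1 : ZMod 2)) ^ 2 = 1 by decide, map_one]
    exact_mod_cast congrArg (Subtype.val) h
  · rcases key (e ⟨x, hx⟩) with h | h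
    · left
      have h' : (⟨x, hx⟩ : H) = 1 := by simpa using h
      exact congrArg Subtype.val h'
    · right
      have h' : (⟨x, hx⟩ : H) = e.symm (Multiplicative.ofAdd 1) := by
        rw [← h, e.symm_apply_apply]
      exact congrArg Subtype.val h'

/-- An involution generates a subgroup isomorphic to `ℤ₂`. -/
theorem nonempty_zpowers_mulEquiv_zmod_two {Γ : Type*} [Group Γ] {g : Γ} (hg : g ^ 2 = 1)
    (hg1 : g ≠ 1) : Nonempty (Subgroup.zpowers g ≃* Multiplicative (ZMod 2)) := by
  have : Fact (Nat.Prime 2) := ⟨Nat.prime_two⟩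
  exact ⟨mulEquivOfPrimeCardEq (p := 2)
    (by rw [Nat.card_zpowers, orderOf_eq_prime hg hg1]) (by simp)⟩

/-- A nonempty set on which a normalized monotone function vanishes is `{1}`. -/
theorem eq_singleton_one_of_apply_eq_zero {Γ : Type*} [Group Γ] {α : Set Γ → ℤ}
    (hpoly : Polymatroidal α) (hnorm : Normalized α) (hnonneg : ∀ X, 0 ≤ α X)
    {S : Set Γ} (hS : S.Nonempty) (h : α S = 0) : S = {1} := by
  refine hS.subset_singleton_iff.1 fun s hs => ?_
  by_contra hs1
  have h1 := hpoly.mono {s} S (Set.singleton_subset_iff.2 hs)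
  exact hnorm.1 s hs1 (le_antisymm (h1.trans h.le) (hnonneg _))

/-- for `k ≥ 1`, `0 ≤ ℓ ≤ k+1`, and a normalized polymatroidal
`α : 2^Γ → {0,…,ℓ}`, the smoothness condition is equivalent to `α(Γ') ≤ k` for every
subgroup `Γ'` of `Γ` isomorphic to `ℤ₂`. -/
theorem statement4 {Γ : Type} [Group Γ] (k ℓ : ℤ) (hk : 1 ≤ k) (hl0 : 0 ≤ ℓ)
    (hlk : ℓ ≤ k + 1) (α : Set Γ → ℤ) (hpoly : Polymatroidal α) (hnorm : Normalized α)
    (hrange : ∀ X : Set Γ, 0 ≤ α X ∧ α X ≤ ℓ) :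
    Smooth α k ↔
      ∀ Γ' : Subgroup Γ, Nonempty (Γ' ≃* Multiplicative (ZMod 2)) → α (↑Γ') ≤ k := by
  constructor
  · rintro hs Γ' ⟨e⟩
    obtain ⟨g, hg, hsub⟩ := exists_involution_of_mulEquiv_zmod_two Γ' e
    by_contra! hlt
    have hle := hpoly.mono _ _ hsub
    exact (hs {1} g (Set.singleton_nonempty 1) (by rw [hnorm.2]; omega)).2 hg
  · intro h S g hS hlt
    have hSg := (hrange (S ∪ {g})).2
    have hS0 := (hrange S).1
    obtain rfl := eq_singleton_one_of_apply_eq_zero hpoly hnorm (fun X => (hrange X).1) hS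
      (by omega)
    refine ⟨rfl, fun hg => ?_⟩
    by_cases hg1 : g = 1
    · subst hg1
      rw [Set.union_self] at hlt
      omega
    · have hle := h _ (nonempty_zpowers_mulEquiv_zmod_two hg hg1)
      have hsub : ({1} ∪ {g} : Set Γ) ⊆ Subgroup.zpowers g := by
        rintro x (rfl | rfl)
        · exact one_mem _
        · exact Subgroup.mem_zpowers x
      have := hpoly.mono _ _ hsub
      omega

end CountMatroidPaper
end

section
/- Let Γ be a finite group and ℓ ≥ 1 an integer. If α: 2^Γ → {0,1,…,ℓ} is a polymatroidal function, then there is a unique inclusion-wise maximal subset S ⊆ Γ with α(S) = 0, and this S is a normal subgroup of Γ. -/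
/- Formalization of count matroids of group-labeled graphs. -/

namespace CountMatroidPaper

attribute [local instance] Classical.propDecidable

variable {V E Γ : Type*}

/-- The zero sets of a nonnegative polymatroidal function are closed under union. -/
theorem Polymatroidal.union_eq_zero {Γ : Type*} [Group Γ] {α : Set Γ → ℤ}
    (hpoly : Polymatroidal α) (hnonneg : ∀ X : Set Γ, 0 ≤ α X) {X Y : Set Γ}
    (hX : α X = 0) (hY : α Y = 0) : α (X ∪ Y) = 0 := by
  have := hpoly.submodular X Y
  have := hnonneg (X ∪ Y)
  have := hnonneg (X ∩ Y)
  omega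

/-- for a polymatroidal `α : 2^Γ → {0,…,ℓ}` on a finite group `Γ`,
there is a unique inclusion-wise maximal subset `S ⊆ Γ` with `α(S) = 0`, and this `S`
is (the carrier of) a normal subgroup of `Γ`. -/
theorem statement5 {Γ : Type} [Group Γ] [Finite Γ] (ℓ : ℤ) (hl : 1 ≤ ℓ)
    (α : Set Γ → ℤ) (hpoly : Polymatroidal α)
    (hrange : ∀ X : Set Γ, 0 ≤ α X ∧ α X ≤ ℓ) :
    ∃ S : Set Γ, Maximal (fun T : Set Γ => α T = 0) S ∧
      (∀ S' : Set Γ, Maximal (fun T : Set Γ => α T = 0) S' → S' = S) ∧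
      ∃ N : Subgroup Γ, N.Normal ∧ (↑N : Set Γ) = S := by
  obtain ⟨S, hS⟩ := (Set.toFinite {T : Set Γ | α T = 0}).exists_maximal ⟨∅, hpoly.empty⟩
  have hle : ∀ T : Set Γ, α T = 0 → T ⊆ S := fun T hT =>
    Set.subset_union_right.trans (hS.2
      (hpoly.union_eq_zero (fun X => (hrange X).1) hS.1 hT) Set.subset_union_left)
  refine ⟨S, hS, fun S' hS' => (hle S' hS'.1).antisymm (hS'.2 hS.1 (hle S' hS'.1)),
    Subgroup.closure S, ?_⟩
  have hclos : (Subgroup.closure S : Set Γ) = S :=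
    (hle _ ((hpoly.clos S).trans hS.1)).antisymm Subgroup.subset_closure
  refine ⟨⟨fun n hn g => ?_⟩, hclos⟩
  rw [← SetLike.mem_coe, hclos] at hn ⊢
  exact hle _ ((hpoly.conj S g).trans hS.1) ⟨n, hn, rfl⟩

end CountMatroidPaper
end

section
/- Let Γ be a finite group. Define α: 2^Γ → ℤ by α(X) = 0 if ⟨X⟩ is trivial, α(X) = 2 if ⟨X⟩ is nontrivial and cyclic, and α(X) = 3 otherwise. Then α is polymatroidal if and only if for each non-identity element g ∈ Γ there is exactly one maximal cyclic subgroup of Γ containing g (a cyclic subgroup is maximal cyclic if it is not properly contained in any cyclic subgroup of Γ). -/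
/- Formalization of count matroids of group-labeled graphs. -/

namespace CountMatroidPaper

attribute [local instance] Classical.propDecidable

variable {V E Γ : Type*}

/-- The function on subsets of a group that is `0`, `2` or `3` according to whether the generated
subgroup is trivial, nontrivial and cyclic, or not cyclic. -/
noncomputable def cyclicRank {G : Type*} [Group G] (X : Set G) : ℤ :=
  if Subgroup.closure X = ⊥ then 0
  else if IsCyclic (Subgroup.closure X) then 2
  else 3

section CyclicSubgroups

variable {G : Type*} [Group G]

theorem isCyclic_of_subgroup_le {H K : Subgroup G} (hK : IsCyclic K) (h : H ≤ K) : IsCyclic H :=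
  isCyclic_of_injective (Subgroup.inclusion h) (Subgroup.inclusion_injective h)

theorem exists_le_maximal_isCyclic [Finite G] {H : Subgroup G} (hH : IsCyclic H) :
    ∃ M : Subgroup G, H ≤ M ∧ IsCyclic M ∧ ∀ K : Subgroup G, IsCyclic K → M ≤ K → K = M := by
  obtain ⟨M, hHM, hM⟩ :=
    Finite.exists_le_maximal (p := fun K : Subgroup G => IsCyclic K) hH
  exact ⟨M, hHM, hM.prop, fun K hK hMK => le_antisymm (hM.le_of_ge hK hMK) hMK⟩

theorem cyclicRank_eq_zero {X : Set G} (h : Subgroup.closure X = ⊥) : cyclicRank X = 0 :=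
  if_pos h

theorem cyclicRank_eq_two {X : Set G} (h : Subgroup.closure X ≠ ⊥)
    (hc : IsCyclic (Subgroup.closure X)) : cyclicRank X = 2 := by
  rw [cyclicRank, if_neg h, if_pos hc]

theorem cyclicRank_eq_three {X : Set G} (hc : ¬ IsCyclic (Subgroup.closure X)) :
    cyclicRank X = 3 := by
  rw [cyclicRank, if_neg, if_neg hc]
  intro h
  exact hc (h ▸ inferInstance)

theorem cyclicRank_le_three (X : Set G) : cyclicRank X ≤ 3 := by
  unfold cyclicRank
  split_ifs <;> norm_num

theorem cyclicRank_le_two {X : Set G} (hc : IsCyclic (Subgroup.closure X)) :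
    cyclicRank X ≤ 2 := by
  unfold cyclicRank
  split_ifs <;> norm_num

theorem two_le_cyclicRank {X : Set G} (h : Subgroup.closure X ≠ ⊥) : 2 ≤ cyclicRank X := by
  rw [cyclicRank, if_neg h]
  split_ifs <;> norm_num

theorem cyclicRank_congr {X Y : Set G} (h : Subgroup.closure X = Subgroup.closure Y) :
    cyclicRank X = cyclicRank Y := by
  unfold cyclicRank
  rw [h]

theorem cyclicRank_mono {X Y : Set G} (h : X ⊆ Y) : cyclicRank X ≤ cyclicRank Y := by
  have hcl := Subgroup.closure_mono h
  by_cases hY : IsCyclic (Subgroup.closure Y)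
  · by_cases hX : Subgroup.closure X = ⊥
    · rw [cyclicRank_eq_zero hX]
      unfold cyclicRank
      split_ifs <;> norm_num
    · have hY' : Subgroup.closure Y ≠ ⊥ := fun hb => hX (le_bot_iff.mp (hb ▸ hcl))
      exact (cyclicRank_le_two (isCyclic_of_subgroup_le hY hcl)).trans (two_le_cyclicRank hY')
  · rw [cyclicRank_eq_three hY]
    exact cyclicRank_le_three X

theorem cyclicRank_conj (X : Set G) (g : G) :
    cyclicRank ((fun x => g * x * g⁻¹) '' X) = cyclicRank X := by
  have hmap : Subgroup.closure ((fun x => g * x * g⁻¹) '' X) =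
      (Subgroup.closure X).map (MulAut.conj g).toMonoidHom := by
    rw [MonoidHom.map_closure]
    rfl
  have hinj : Function.Injective (MulAut.conj g).toMonoidHom := (MulAut.conj g).injective
  have hbot : Subgroup.closure ((fun x => g * x * g⁻¹) '' X) = ⊥ ↔ Subgroup.closure X = ⊥ := by
    rw [hmap, Subgroup.map_eq_bot_iff_of_injective _ hinj]
  have hcyc : IsCyclic (Subgroup.closure ((fun x => g * x * g⁻¹) '' X)) ↔
      IsCyclic (Subgroup.closure X) := by
    rw [hmap]
    exact ((Subgroup.closure X).equivMapOfInjective _ hinj).isCyclic.symm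
  unfold cyclicRank
  simp only [hbot, hcyc]

theorem isCyclic_closure_union [Finite G]
    (huniq : ∀ g : G, g ≠ 1 → ∃! H : Subgroup G,
      IsCyclic H ∧ g ∈ H ∧ ∀ K : Subgroup G, IsCyclic K → H ≤ K → K = H)
    {X Y : Set G} (hX : IsCyclic (Subgroup.closure X)) (hY : IsCyclic (Subgroup.closure Y))
    (hXY : Subgroup.closure (X ∩ Y) ≠ ⊥) : IsCyclic (Subgroup.closure (X ∪ Y)) := by
  obtain ⟨g, hg, hg1⟩ := (Subgroup.bot_or_exists_ne_one _).resolve_left hXY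
  obtain ⟨M, hXM, hM, hMmax⟩ := exists_le_maximal_isCyclic hX
  obtain ⟨N, hYN, hN, hNmax⟩ := exists_le_maximal_isCyclic hY
  have hgM : g ∈ M := hXM (Subgroup.closure_mono Set.inter_subset_left hg)
  have hgN : g ∈ N := hYN (Subgroup.closure_mono Set.inter_subset_right hg)
  obtain rfl : M = N := (huniq g hg1).unique ⟨hM, hgM, hMmax⟩ ⟨hN, hgN, hNmax⟩
  refine isCyclic_of_subgroup_le hM ?_
  rw [Subgroup.closure_union]
  exact sup_le hXM hYN

theorem cyclicRank_submodular [Finite G]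
    (huniq : ∀ g : G, g ≠ 1 → ∃! H : Subgroup G,
      IsCyclic H ∧ g ∈ H ∧ ∀ K : Subgroup G, IsCyclic K → H ≤ K → K = H) (X Y : Set G) :
    cyclicRank (X ∪ Y) + cyclicRank (X ∩ Y) ≤ cyclicRank X + cyclicRank Y := by
  have hl : cyclicRank (X ∩ Y) ≤ cyclicRank X := cyclicRank_mono Set.inter_subset_left
  have hr : cyclicRank (X ∩ Y) ≤ cyclicRank Y := cyclicRank_mono Set.inter_subset_right
  have hu := cyclicRank_le_three (X ∪ Y)
  by_cases hXbot : Subgroup.closure X = ⊥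
  · rw [cyclicRank_congr (X := X ∪ Y) (Y := Y) (by rw [Subgroup.closure_union, hXbot, bot_sup_eq])]
    linarith
  by_cases hYbot : Subgroup.closure Y = ⊥
  · rw [cyclicRank_congr (X := X ∪ Y) (Y := X) (by rw [Subgroup.closure_union, hYbot, sup_bot_eq])]
    linarith
  by_cases hX : IsCyclic (Subgroup.closure X)
  · by_cases hY : IsCyclic (Subgroup.closure Y)
    · rw [cyclicRank_eq_two hXbot hX, cyclicRank_eq_two hYbot hY] at *
      by_cases hXY : Subgroup.closure (X ∩ Y) = ⊥
      · rw [cyclicRank_eq_zero hXY]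
        linarith
      · have := cyclicRank_le_two (isCyclic_closure_union huniq hX hY hXY)
        linarith
    · rw [cyclicRank_eq_three hY]
      linarith
  · rw [cyclicRank_eq_three hX]
    linarith

theorem eq_of_maximal_isCyclic_of_submodular
    (hsub : ∀ X Y : Set G,
      cyclicRank (X ∪ Y) + cyclicRank (X ∩ Y) ≤ cyclicRank X + cyclicRank Y)
    {g : G} (hg : g ≠ 1) {H K : Subgroup G} (hH : IsCyclic H) (hK : IsCyclic K)
    (hgH : g ∈ H) (hgK : g ∈ K)
    (hHmax : ∀ L : Subgroup G, IsCyclic L → H ≤ L → L = H)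
    (hKmax : ∀ L : Subgroup G, IsCyclic L → K ≤ L → L = K) : H = K := by
  have h := hsub H K
  have hcH : cyclicRank (H : Set G) ≤ 2 := cyclicRank_le_two (by rwa [Subgroup.closure_eq])
  have hcK : cyclicRank (K : Set G) ≤ 2 := cyclicRank_le_two (by rwa [Subgroup.closure_eq])
  have hi : 2 ≤ cyclicRank ((H : Set G) ∩ K) := two_le_cyclicRank fun hb =>
    hg (Subgroup.mem_bot.mp (hb ▸ Subgroup.subset_closure ⟨hgH, hgK⟩))
  have hcyc : IsCyclic (Subgroup.closure ((H : Set G) ∪ K)) := by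
    by_contra hn
    rw [cyclicRank_eq_three hn] at h
    linarith
  rw [Subgroup.closure_union, Subgroup.closure_eq, Subgroup.closure_eq] at hcyc
  exact (hHmax _ hcyc le_sup_left).symm.trans (hKmax _ hcyc le_sup_right)

end CyclicSubgroups

/-- Lemma in Example 4: the function with `α(X) = 0` if `⟨X⟩` is trivial,
`α(X) = 2` if `⟨X⟩` is nontrivial cyclic, and `α(X) = 3` otherwise, is polymatroidal
iff every non-identity `g ∈ Γ` lies in exactly one maximal cyclic subgroup of `Γ`. -/
theorem statement6 {Γ : Type} [Group Γ] [Finite Γ] :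
    Polymatroidal (fun X : Set Γ =>
      if Subgroup.closure X = ⊥ then 0
      else if IsCyclic (Subgroup.closure X) then 2
      else 3) ↔
    ∀ g : Γ, g ≠ 1 → ∃! H : Subgroup Γ,
      IsCyclic H ∧ g ∈ H ∧ ∀ K : Subgroup Γ, IsCyclic K → H ≤ K → K = H := by
  change Polymatroidal (cyclicRank (G := Γ)) ↔ _
  constructor
  · intro hα g hg
    obtain ⟨M, hle, hM, hMmax⟩ :=
      exists_le_maximal_isCyclic (H := Subgroup.zpowers g) inferInstance
    have hgM : g ∈ M := hle (Subgroup.mem_zpowers g)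
    exact ⟨M, ⟨hM, hgM, hMmax⟩, fun K ⟨hK, hgK, hKmax⟩ =>
      eq_of_maximal_isCyclic_of_submodular hα.submodular hg hK hM hgK hgM hKmax hMmax⟩
  · intro huniq
    exact
      { empty := cyclicRank_eq_zero Subgroup.closure_empty
        submodular := cyclicRank_submodular huniq
        mono := fun _ _ => cyclicRank_mono
        conj := cyclicRank_conj
        clos := fun X => cyclicRank_congr (Subgroup.closure_eq _) }

end CountMatroidPaper
end

section
/- Let n, i be positive integers with i < n and let Γ = ℤ_n. Define α: 2^{ℤ_n} → ℤ by α(X) = 0 if ⟨X⟩ is trivial; α(X) = 1 if i is odd and ⟨X⟩ ≅ ℤ₂; α(X) = 2 if ⟨X⟩ ≅ ℤ_m for some m ∈ S(n,i); and α(X) = 3 otherwise. Then α is polymatroidal. -/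
/- Formalization of count matroids of group-labeled graphs. -/

namespace CountMatroidPaper

attribute [local instance] Classical.propDecidable

variable {V E Γ : Type*}

/-- The set `S(n,i)`. -/
def SSet (n i : ℕ) : Set ℕ :=
  {m : ℕ | 2 ≤ m ∧ m ≤ n ∧ m ∣ n ∧ (m ∣ i ∨ m ∣ (i - 1) ∨ m ∣ (i + 1)) ∧ (Odd i → m ≠ 2)}

/-- The value of `α` on a subgroup of order `c`. -/
noncomputable def orderValue (n i c : ℕ) : ℤ :=
  if c = 1 then 0 else if Odd i ∧ c = 2 then 1 else if c ∈ SSet n i then 2 else 3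

lemma orderValue_le_three (n i c : ℕ) : orderValue n i c ≤ 3 := by
  unfold orderValue; split_ifs <;> norm_num

lemma mem_SSet_of_dvd {n i a b : ℕ} (hn : 0 < n) (hb : b ∈ SSet n i) (hab : a ∣ b)
    (ha : a ≠ 1) (ha' : Odd i → a ≠ 2) : a ∈ SSet n i := by
  obtain ⟨-, -, hbn, hbi, -⟩ := hb
  have han := hab.trans hbn
  have := Nat.pos_of_dvd_of_pos han hn
  exact ⟨by omega, Nat.le_of_dvd hn han, han,
    hbi.imp hab.trans (Or.imp hab.trans hab.trans), ha'⟩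

lemma orderValue_mono {n i a b : ℕ} (hn : 0 < n) (hab : a ∣ b) :
    orderValue n i a ≤ orderValue n i b := by
  have ha : b = 1 → a = 1 := fun h => Nat.dvd_one.1 (h ▸ hab)
  have ha2 : b = 2 → a = 1 ∨ a = 2 := fun h => (Nat.dvd_prime Nat.prime_two).1 (h ▸ hab)
  have hS := fun hb => mem_SSet_of_dvd (i := i) hn hb hab
  unfold orderValue
  split_ifs <;> grind

/-- Two elements of `S(n,i)` with a large enough common divisor divide the same one of
`i - 1`, `i`, `i + 1`. -/
lemma lcm_mem_SSet {n i h k t : ℕ} (hn : 0 < n) (hi : 0 < i) (hh : h ∈ SSet n i)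
    (hk : k ∈ SSet n i) (hth : t ∣ h) (htk : t ∣ k) (ht : t ≠ 1) (ht' : Odd i → t ≠ 2) :
    h.lcm k ∈ SSet n i := by
  obtain ⟨h2, -, hhn, hhi, hh'⟩ := hh
  obtain ⟨k2, -, hkn, hki, -⟩ := hk
  have hln : h.lcm k ∣ n := Nat.lcm_dvd hhn hkn
  have hl := Nat.le_of_dvd (Nat.pos_of_dvd_of_pos hln hn) (Nat.dvd_lcm_left h k)
  have consecutive : ∀ a, t ∣ a → t ∣ a + 1 → False := fun a h₀ h₁ =>
    ht (Nat.dvd_one.1 ((Nat.dvd_add_right h₀).1 h₁))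
  have gap : t ∣ i - 1 → t ∣ i + 1 → False := fun h₀ h₁ => by
    have h₂ : t ∣ 2 := (Nat.dvd_add_right h₀).1 (by convert h₁ using 1; omega)
    obtain rfl : t = 2 := ((Nat.dvd_prime Nat.prime_two).1 h₂).resolve_left ht
    exact ht' (by grind) rfl
  have below : t ∣ i - 1 → t ∣ i → False := fun h₀ h₁ =>
    consecutive _ h₀ (by rwa [Nat.sub_add_cancel hi])
  refine ⟨h2.trans hl, Nat.le_of_dvd hn hln, hln, ?_, fun ho h => ?_⟩
  · rcases hhi with a | a | a <;> rcases hki with b | b | b <;>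
      have a' := hth.trans a <;> have b' := htk.trans b
    · exact .inl (Nat.lcm_dvd a b)
    · exact (below b' a').elim
    · exact (consecutive _ a' b').elim
    · exact (below a' b').elim
    · exact .inr (.inl (Nat.lcm_dvd a b))
    · exact (gap a' b').elim
    · exact (consecutive _ b' a').elim
    · exact (gap b' a').elim
    · exact .inr (.inr (Nat.lcm_dvd a b))
  · exact hh' ho (by omega)

lemma orderValue_submodular {n i h k t : ℕ} (hn : 0 < n) (hi : 0 < i)
    (hth : t ∣ h) (htk : t ∣ k) :
    orderValue n i (h.lcm k) + orderValue n i t ≤ orderValue n i h + orderValue n i k := by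
  have hl := orderValue_le_three n i (h.lcm k)
  have mh := orderValue_mono (i := i) hn hth
  have mk := orderValue_mono (i := i) hn htk
  by_cases hhk : h ∣ k
  · rw [Nat.lcm_eq_right hhk]; omega
  by_cases hkh : k ∣ h
  · rw [Nat.lcm_eq_left hkh]; omega
  have h1 : h ≠ 1 := by rintro rfl; exact hhk (one_dvd _)
  have k1 : k ≠ 1 := by rintro rfl; exact hkh (one_dvd _)
  have h2 : h = 2 → t = 1 := by
    rintro rfl
    exact ((Nat.dvd_prime Nat.prime_two).1 hth).resolve_right (by rintro rfl; exact hhk htk)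
  have k2 : k = 2 → t = 1 := by
    rintro rfl
    exact ((Nat.dvd_prime Nat.prime_two).1 htk).resolve_right (by rintro rfl; exact hkh hth)
  have hne : h ≠ k := by rintro rfl; exact hhk dvd_rfl
  have h3 := fun a b => lcm_mem_SSet (i := i) hn hi a b hth htk
  have hl2 : h.lcm k ∈ SSet n i → orderValue n i (h.lcm k) ≤ 2 := fun hm => by
    simp only [orderValue, hm, if_true]; split_ifs <;> norm_num
  generalize orderValue n i (h.lcm k) = v at *
  simp only [orderValue] at *
  split_ifs at * <;> grind

lemma nonempty_mulEquiv_iff {G : Type*} [Group G] [IsCyclic G] {m : ℕ} :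
    Nonempty (G ≃* Multiplicative (ZMod m)) ↔ Nat.card G = m := by
  refine ⟨fun ⟨e⟩ => ?_, fun h => ⟨mulEquivOfCyclicCardEq ?_⟩⟩
  · rw [Nat.card_congr e.toEquiv, Nat.card_congr Multiplicative.toAdd, Nat.card_zmod]
  · rw [h, Nat.card_congr Multiplicative.toAdd, Nat.card_zmod]

lemma card_dvd_iff_le_ker {G : Type*} [CommGroup G] [IsCyclic G] (H : Subgroup G) (k : ℕ) :
    Nat.card H ∣ k ↔ H ≤ (powMonoidHom k : G →* G).ker := by
  rw [← IsCyclic.exponent_eq_card, Monoid.exponent_dvd_iff_forall_pow_eq_one]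
  simp [SetLike.le_def, MonoidHom.mem_ker, Subtype.ext_iff]

lemma card_sup_eq_lcm {G : Type*} [CommGroup G] [IsCyclic G] (H K : Subgroup G) :
    Nat.card (H ⊔ K : Subgroup G) = (Nat.card H).lcm (Nat.card K) := by
  apply Nat.dvd_antisymm
  · rw [card_dvd_iff_le_ker, sup_le_iff, ← card_dvd_iff_le_ker, ← card_dvd_iff_le_ker]
    exact ⟨Nat.dvd_lcm_left _ _, Nat.dvd_lcm_right _ _⟩
  · exact Nat.lcm_dvd (Subgroup.card_dvd_of_le le_sup_left) (Subgroup.card_dvd_of_le le_sup_right)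

/-- Lemma in Example 5: for positive integers `i < n`, the function on
`2^{ℤ_n}` with value `0` if `⟨X⟩` is trivial, `1` if `i` is odd and `⟨X⟩ ≅ ℤ₂`, `2` if
`⟨X⟩ ≅ ℤ_m` for some `m ∈ S(n,i)`, and `3` otherwise, is polymatroidal. -/
theorem statement7 (n i : ℕ) (hn : 0 < n) (hi : 0 < i) (hin : i < n) :
    Polymatroidal (fun X : Set (Multiplicative (ZMod n)) =>
      if Subgroup.closure X = ⊥ then 0
      else if Odd i ∧ Nonempty ((Subgroup.closure X) ≃* Multiplicative (ZMod 2)) then 1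
      else if ∃ m ∈ SSet n i, Nonempty ((Subgroup.closure X) ≃* Multiplicative (ZMod m)) then 2
      else 3) := by
  have value_eq : ∀ H : Subgroup (Multiplicative (ZMod n)),
      (if H = ⊥ then (0 : ℤ)
        else if Odd i ∧ Nonempty (H ≃* Multiplicative (ZMod 2)) then 1
        else if ∃ m ∈ SSet n i, Nonempty (H ≃* Multiplicative (ZMod m)) then 2
        else 3) = orderValue n i (Nat.card H) := fun H => by
    simp only [nonempty_mulEquiv_iff, ← Subgroup.card_eq_one, orderValue, exists_eq_right']
  simp only [value_eq]
  constructor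
  · simp [orderValue]
  · intro X Y
    rw [Subgroup.closure_union, card_sup_eq_lcm]
    exact orderValue_submodular hn hi
      (Subgroup.card_dvd_of_le (Subgroup.closure_mono Set.inter_subset_left))
      (Subgroup.card_dvd_of_le (Subgroup.closure_mono Set.inter_subset_right))
  · exact fun X Y hXY => orderValue_mono hn (Subgroup.card_dvd_of_le (Subgroup.closure_mono hXY))
  · simp
  · simp

end CountMatroidPaper
end
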